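/- Let p and q be real numbers with p > q > 0. Then the improper integral I^±_{p,q} := ∫₀^∞ e^{±i x^p} x^{q−1} dx, understood as the limit of ∫_r^R e^{±i x^p} x^{q−1} dx as r → 0⁺ and R → ∞, converges, and I^±_{p,q} = p^{−1} e^{±iπq/(2p)} Γ(q/p), where the double signs are taken in the same order. -/

import Mathlib

open MeasureTheory Filter Topology Set

/-- Substituting `u = p * log x` in an integral of the form `∫ h (x ^ p) * x ^ (q - 1)`. -/
lemma integral_comp_rpow_mul_rpow {h : ℝ → ℂ} (hh : Continuous h) {p q r R : ℝ} (hp : 0 < p)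
    (hr : 0 < r) (hR : r ≤ R) :
    ∫ x in r..R, h (x ^ p) * ((x ^ (q - 1) : ℝ) : ℂ) =
      (p : ℂ)⁻¹ * ∫ u in (p * Real.log r)..(p * Real.log R),
        h (Real.exp u) * ((Real.exp (q / p * u) : ℝ) : ℂ) := by
  have hpos : ∀ x ∈ uIcc r R, 0 < x := fun x hx => by
    rw [uIcc_of_le hR] at hx
    exact hr.trans_le hx.1
  have key := intervalIntegral.integral_deriv_smul_comp (a := r) (b := R)
    (f := fun x => p * Real.log x) (f' := fun x => p * x⁻¹)
    (g := fun u => h (Real.exp u) * ((Real.exp (q / p * u) : ℝ) : ℂ))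
    (fun x hx => (Real.hasDerivAt_log (hpos x hx).ne').const_mul p)
    (continuousOn_const.mul (continuousOn_id.inv₀ fun x hx => (hpos x hx).ne'))
    (by fun_prop)
  rw [← key, ← intervalIntegral.integral_const_mul]
  refine intervalIntegral.integral_congr fun x hx => ?_
  have hx0 := hpos x hx
  have h1 : Real.exp (p * Real.log x) = x ^ p := by rw [Real.rpow_def_of_pos hx0, mul_comm]
  have h2 : Real.exp (q / p * (p * Real.log x)) = x ^ q := by
    rw [Real.rpow_def_of_pos hx0]
    congr 1
    field_simp
  have hpc : (p : ℂ) ≠ 0 := by exact_mod_cast hp.ne'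
  have hxc : (x : ℂ) ≠ 0 := by exact_mod_cast hx0.ne'
  simp only [Function.comp, h1, h2, Real.rpow_sub_one hx0.ne', Complex.real_smul]
  push_cast
  field_simp

/-- Euler's integral for `Γ` after the substitution `t = exp x`. -/
lemma tendsto_integral_exp_neg_exp {ι : Type*} {l : Filter ι} [l.IsCountablyGenerated]
    {u v : ι → ℝ} (hu : Tendsto u l atBot) (hv : Tendsto v l atTop) {a : ℝ} (ha : 0 < a) :
    Tendsto (fun i => ∫ x in (u i)..(v i), Complex.exp (-Complex.exp x + a * x)) l
      (𝓝 (Complex.Gamma a)) := by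
  have hcover : AECover (volume.restrict (Ioi (0 : ℝ))) l
      fun i => Ioi (Real.exp (u i)) ∩ Iic (Real.exp (v i)) :=
    (aecover_Ioi_of_Ioi (Real.tendsto_exp_atBot.comp hu)).inter
      (aecover_Iic (Real.tendsto_exp_atTop.comp hv))
  have hlim := hcover.integral_tendsto_of_countably_generated
    (Complex.GammaIntegral_convergent (s := a) (by simpa using ha))
  rw [Complex.Gamma_eq_integral (by simpa using ha), Complex.GammaIntegral]
  refine hlim.congr' ?_
  filter_upwards [hu.eventually (eventually_le_atBot 0), hv.eventually (eventually_ge_atTop 0)]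
    with i hui hvi
  have hsub := integral_comp_rpow_mul_rpow (h := fun t => ((Real.exp (-t) : ℝ) : ℂ))
    (by fun_prop) (p := 1) (q := a) one_pos (Real.exp_pos (u i))
    (Real.exp_le_exp.2 (hui.trans hvi))
  simp only [Real.rpow_one, Real.log_exp, one_mul, div_one, Complex.ofReal_one, inv_one] at hsub
  rw [Measure.restrict_restrict (measurableSet_Ioi.inter measurableSet_Iic)]
  have hset : Ioi (Real.exp (u i)) ∩ Iic (Real.exp (v i)) ∩ Ioi 0
      = Ioc (Real.exp (u i)) (Real.exp (v i)) := by
    ext x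
    exact ⟨fun hx => hx.1, fun hx => ⟨hx, (Real.exp_pos (u i)).trans hx.1⟩⟩
  rw [hset]
  have hexp : ∀ x : ℝ, Complex.exp (-Complex.exp x + a * x) =
      ((Real.exp (-Real.exp x) : ℝ) : ℂ) * ((Real.exp (a * x) : ℝ) : ℂ) := fun x => by
    rw [Complex.exp_add]
    push_cast
    rfl
  simp only [hexp]
  rw [← hsub, intervalIntegral.integral_of_le (Real.exp_le_exp.2 (hui.trans hvi))]
  refine setIntegral_congr_fun measurableSet_Ioc fun x hx => ?_
  have hx0 : 0 ≤ x := (Real.exp_pos (u i)).le.trans hx.1.le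
  simp [Complex.ofReal_cpow hx0]

lemma norm_exp_neg_exp (a u y : ℝ) :
    ‖Complex.exp (-Complex.exp (u + y * Complex.I) + a * (u + y * Complex.I))‖ =
      Real.exp (a * u) * Real.exp (-(Real.exp u * Real.cos y)) := by
  rw [Complex.norm_exp, ← Real.exp_add]
  congr 1
  simp [Complex.exp_re]
  ring

/-- Jordan's inequality in integrated form. -/
lemma integral_exp_neg_mul_cos_le {T : ℝ} (hT : 0 < T) :
    ∫ y in (0 : ℝ)..(Real.pi / 2), Real.exp (-(T * Real.cos y)) ≤ Real.pi / 2 * T⁻¹ := by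
  have hpi := Real.pi_pos
  have hderiv : ∀ y : ℝ, HasDerivAt
      (fun y => Real.pi / 2 * T⁻¹ * Real.exp (T * (2 / Real.pi * y - 1)))
      (Real.exp (T * (2 / Real.pi * y - 1))) y := fun y => by
    have := (((((hasDerivAt_id y).const_mul (2 / Real.pi)).sub_const 1).const_mul T).exp).const_mul
      (Real.pi / 2 * T⁻¹)
    refine this.congr_deriv ?_
    simp only [id]
    field_simp
  calc ∫ y in (0 : ℝ)..(Real.pi / 2), Real.exp (-(T * Real.cos y))
      ≤ ∫ y in (0 : ℝ)..(Real.pi / 2), Real.exp (T * (2 / Real.pi * y - 1)) := by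
        refine intervalIntegral.integral_mono_on (by positivity)
          (Continuous.intervalIntegrable (by fun_prop) _ _)
          (Continuous.intervalIntegrable (by fun_prop) _ _) fun y hy => ?_
        have := mul_le_mul_of_nonneg_left (Real.one_sub_mul_le_cos hy.1 hy.2) hT.le
        exact Real.exp_le_exp.2 (by linarith)
    _ = Real.pi / 2 * T⁻¹ * Real.exp (T * (2 / Real.pi * (Real.pi / 2) - 1))
        - Real.pi / 2 * T⁻¹ * Real.exp (T * (2 / Real.pi * 0 - 1)) :=
        intervalIntegral.integral_eq_sub_of_hasDerivAt (fun y _ => hderiv y)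
          (Continuous.intervalIntegrable (by fun_prop) _ _)
    _ ≤ Real.pi / 2 * T⁻¹ := by
        have h1 : T * (2 / Real.pi * (Real.pi / 2) - 1) = 0 := by field_simp; simp
        rw [h1, Real.exp_zero, mul_one]
        have : 0 ≤ Real.pi / 2 * T⁻¹ * Real.exp (T * (2 / Real.pi * 0 - 1)) := by positivity
        linarith

lemma integral_exp_neg_mul_cos_le_pi_div_two {T : ℝ} (hT : 0 ≤ T) :
    ∫ y in (0 : ℝ)..(Real.pi / 2), Real.exp (-(T * Real.cos y)) ≤ Real.pi / 2 := by
  have hpi := Real.pi_pos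
  calc ∫ y in (0 : ℝ)..(Real.pi / 2), Real.exp (-(T * Real.cos y))
      ≤ ∫ _ in (0 : ℝ)..(Real.pi / 2), (1 : ℝ) := by
        refine intervalIntegral.integral_mono_on (by positivity)
          (Continuous.intervalIntegrable (by fun_prop) _ _)
          (Continuous.intervalIntegrable (by fun_prop) _ _) fun y hy => ?_
        have := Real.cos_nonneg_of_mem_Icc ⟨by linarith [hy.1], hy.2⟩
        exact Real.exp_le_one_iff.2 (by nlinarith)
    _ = Real.pi / 2 := by simp

lemma norm_integral_vertical_le (a u : ℝ) {s : ℝ} (hs : s = 1 ∨ s = -1) :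
    ‖∫ y in (0 : ℝ)..(-(s * (Real.pi / 2))),
        Complex.exp (-Complex.exp (u + y * Complex.I) + a * (u + y * Complex.I))‖ ≤
      Real.exp (a * u) *
        ∫ y in (0 : ℝ)..(Real.pi / 2), Real.exp (-(Real.exp u * Real.cos y)) := by
  have hpi : (0 : ℝ) ≤ Real.pi / 2 := by positivity
  rw [← intervalIntegral.integral_const_mul]
  rcases hs with rfl | rfl
  · have hneg := intervalIntegral.integral_comp_neg (a := 0) (b := Real.pi / 2) fun y : ℝ =>
      Complex.exp (-Complex.exp (u + y * Complex.I) + a * (u + y * Complex.I))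
    rw [neg_zero] at hneg
    rw [one_mul, intervalIntegral.integral_symm, ← hneg, norm_neg]
    refine (intervalIntegral.norm_integral_le_integral_norm hpi).trans_eq ?_
    simp only [norm_exp_neg_exp, Real.cos_neg]
  · rw [neg_one_mul, neg_neg]
    refine (intervalIntegral.norm_integral_le_integral_norm hpi).trans_eq ?_
    simp only [norm_exp_neg_exp]

lemma tendsto_integral_vertical_atBot {a : ℝ} (ha : 0 < a) {s : ℝ} (hs : s = 1 ∨ s = -1) :
    Tendsto (fun u : ℝ => ∫ y in (0 : ℝ)..(-(s * (Real.pi / 2))),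
        Complex.exp (-Complex.exp (u + y * Complex.I) + a * (u + y * Complex.I)))
      atBot (𝓝 0) := by
  refine squeeze_zero_norm (a := fun u => Real.exp (a * u) * (Real.pi / 2)) (fun u =>
    (norm_integral_vertical_le a u hs).trans (mul_le_mul_of_nonneg_left
      (integral_exp_neg_mul_cos_le_pi_div_two (Real.exp_pos u).le) (Real.exp_pos _).le)) ?_
  simpa using (Real.tendsto_exp_atBot.comp (tendsto_id.const_mul_atBot ha)).mul_const (Real.pi / 2)

lemma tendsto_integral_vertical_atTop {a : ℝ} (ha : a < 1) {s : ℝ} (hs : s = 1 ∨ s = -1) :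
    Tendsto (fun u : ℝ => ∫ y in (0 : ℝ)..(-(s * (Real.pi / 2))),
        Complex.exp (-Complex.exp (u + y * Complex.I) + a * (u + y * Complex.I)))
      atTop (𝓝 0) := by
  refine squeeze_zero_norm (a := fun u => Real.exp (a * u) * (Real.pi / 2 * (Real.exp u)⁻¹))
    (fun u => (norm_integral_vertical_le a u hs).trans (mul_le_mul_of_nonneg_left
      (integral_exp_neg_mul_cos_le (Real.exp_pos u)) (Real.exp_pos _).le)) ?_
  have heq : ∀ u, Real.exp (a * u) * (Real.pi / 2 * (Real.exp u)⁻¹) =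
      Real.exp ((a - 1) * u) * (Real.pi / 2) := fun u => by
    rw [sub_mul, one_mul, Real.exp_sub]
    ring
  simp only [heq]
  simpa using (Real.tendsto_exp_atBot.comp
    (tendsto_id.const_mul_atTop_of_neg (sub_neg.2 ha))).mul_const (Real.pi / 2)

/-- Values of `exp (-exp w + a * w)` on the line `im w = -s * π / 2`. -/
lemma exp_neg_exp_horizontal (a x : ℝ) {s : ℝ} (hs : s = 1 ∨ s = -1) :
    Complex.exp (-Complex.exp (x + (-(s * (Real.pi / 2)) : ℝ) * Complex.I)
        + a * (x + (-(s * (Real.pi / 2)) : ℝ) * Complex.I)) =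
      Complex.exp (-(s * Complex.I * (Real.pi / 2 * a : ℝ))) *
        (Complex.exp (s * Complex.I * (Real.exp x : ℝ)) * ((Real.exp (a * x) : ℝ) : ℂ)) := by
  have hrot : Complex.exp ((-(s * (Real.pi / 2)) : ℝ) * Complex.I) = -(s * Complex.I) := by
    rw [Complex.exp_mul_I, ← Complex.ofReal_cos, ← Complex.ofReal_sin]
    rcases hs with rfl | rfl <;> simp
  rw [Complex.exp_add (x : ℂ), hrot]
  push_cast
  rw [← Complex.exp_add, ← Complex.exp_add]
  congr 1
  ring

/-- Rotating the ray of integration of `Γ` onto the imaginary axis, in logarithmic coordinates. -/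
lemma tendsto_integral_exp_I_mul_exp {ι : Type*} {l : Filter ι} [l.IsCountablyGenerated]
    {u v : ι → ℝ} (hu : Tendsto u l atBot) (hv : Tendsto v l atTop) {a : ℝ} (ha : 0 < a)
    (ha1 : a < 1) {s : ℝ} (hs : s = 1 ∨ s = -1) :
    Tendsto (fun i => ∫ x in (u i)..(v i),
        Complex.exp (s * Complex.I * (Real.exp x : ℝ)) * ((Real.exp (a * x) : ℝ) : ℂ)) l
      (𝓝 (Complex.exp (s * Complex.I * (Real.pi / 2 * a : ℝ)) * Complex.Gamma a)) := by
  set f : ℂ → ℂ := fun w => Complex.exp (-Complex.exp w + a * w) with hf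
  have hlim := (((tendsto_integral_exp_neg_exp hu hv ha).add
    (((tendsto_integral_vertical_atTop ha1 hs).comp hv).const_mul Complex.I)).sub
    (((tendsto_integral_vertical_atBot ha hs).comp hu).const_mul Complex.I)).const_mul
    (Complex.exp (s * Complex.I * (Real.pi / 2 * a : ℝ)))
  simp only [mul_zero, add_zero, sub_zero] at hlim
  refine hlim.congr fun i => ?_
  have hrect := Complex.integral_boundary_rect_eq_zero_of_differentiableOn f (u i : ℂ)
    ((v i : ℂ) + (-(s * (Real.pi / 2)) : ℝ) * Complex.I)
    (Differentiable.differentiableOn (by rw [hf]; fun_prop))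
  simp only [Complex.add_re, Complex.add_im, Complex.ofReal_re, Complex.ofReal_im,
    Complex.re_ofReal_mul, Complex.im_ofReal_mul, Complex.I_re, Complex.I_im, mul_zero, mul_one,
    add_zero, zero_add, Complex.ofReal_zero, zero_mul, smul_eq_mul] at hrect
  simp only [hf, exp_neg_exp_horizontal a _ hs, intervalIntegral.integral_const_mul] at hrect
  set J := ∫ x in (u i)..(v i),
    Complex.exp (s * Complex.I * (Real.exp x : ℝ)) * ((Real.exp (a * x) : ℝ) : ℂ)
  have hcancel : Complex.exp (s * Complex.I * (Real.pi / 2 * a : ℝ)) *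
      (Complex.exp (-(s * Complex.I * (Real.pi / 2 * a : ℝ))) * J) = J := by
    rw [← mul_assoc, ← Complex.exp_add, add_neg_cancel, Complex.exp_zero, one_mul]
  refine Eq.trans ?_ hcancel
  congr 1
  simp only [Function.comp]
  linear_combination hrect

/-- **Generalized Fresnel integrals as improper Riemann integrals.**
For real `p > q > 0` and either sign `s = ±1`, the improper integral
`∫₀^∞ e^{±i x^p} x^{q-1} dx`, understood as the limit of `∫_r^R` as `r → 0⁺`, `R → ∞`,
converges to `p⁻¹ e^{±iπq/(2p)} Γ(q/p)`. -/
theorem generalized_fresnel_improper (p q : ℝ) (hq : 0 < q) (hpq : q < p)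
    (s : ℝ) (hs : s = 1 ∨ s = -1) :
    Tendsto
      (fun rR : ℝ × ℝ => ∫ x in rR.1..rR.2,
        Complex.exp (s * Complex.I * ((x ^ p : ℝ) : ℂ)) * ((x ^ (q - 1) : ℝ) : ℂ))
      ((𝓝[>] (0 : ℝ)) ×ˢ (atTop : Filter ℝ))
      (𝓝 ((p : ℂ)⁻¹ * Complex.exp (s * Complex.I * ((Real.pi / 2) * (q / p) : ℝ)) *
        Complex.Gamma ((q / p : ℝ) : ℂ))) := by
  have hp : 0 < p := hq.trans hpq
  have hu : Tendsto (fun rR : ℝ × ℝ => p * Real.log rR.1) ((𝓝[>] (0 : ℝ)) ×ˢ atTop) atBot :=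
    (Real.tendsto_log_nhdsGT_zero.const_mul_atBot hp).comp tendsto_fst
  have hv : Tendsto (fun rR : ℝ × ℝ => p * Real.log rR.2) ((𝓝[>] (0 : ℝ)) ×ˢ atTop) atTop :=
    (Real.tendsto_log_atTop.const_mul_atTop hp).comp tendsto_snd
  have hlim := (tendsto_integral_exp_I_mul_exp hu hv (div_pos hq hp)
    ((div_lt_one hp).2 hpq) hs).const_mul (p : ℂ)⁻¹
  rw [← mul_assoc] at hlim
  refine hlim.congr' ?_
  have hr : ∀ᶠ r : ℝ in 𝓝[>] 0, r ∈ Ioc 0 1 := Ioc_mem_nhdsGT one_pos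
  filter_upwards [hr.prod_mk (eventually_ge_atTop (1 : ℝ))] with rR h
  exact (integral_comp_rpow_mul_rpow (h := fun t => Complex.exp (s * Complex.I * (t : ℂ)))
    (by fun_prop) hp h.1.1 (h.1.2.trans h.2)).symm
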